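/- For a positive integer w, let κ(2,w) denote the number of equivalence classes of 2-dimensional convex lattice polytopes P with |P ∩ ℤ²| = w. Then κ(2,3) = 1, κ(2,4) = 3, κ(2,5) = 6, κ(2,6) = 13, and κ(2,7) = 21. -/

import Mathlib

open MeasureTheory

noncomputable section

/-- The canonical embedding of integer vectors into real vectors. -/
def intVec {d : ℕ} (x : Fin d → ℤ) : Fin d → ℝ := fun i => (x i : ℝ)

/-- `P` is a convex lattice polytope: the convex hull of a finite set of lattice points. -/
def IsConvexLatticePolytope (d : ℕ) (P : Set (Fin d → ℝ)) : Prop :=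
  ∃ V : Finset (Fin d → ℤ), P = convexHull ℝ (intVec '' (V : Set (Fin d → ℤ)))

/-- `P` is `d`-dimensional: its affine span is all of `ℝ^d`. -/
def IsFullDim (d : ℕ) (P : Set (Fin d → ℝ)) : Prop :=
  affineSpan ℝ P = ⊤

/-- The set of lattice points of `P`. -/
def latticePts (d : ℕ) (P : Set (Fin d → ℝ)) : Set (Fin d → ℤ) :=
  {x | intVec x ∈ P}

/-- The lattice `ℤ^d` viewed inside `ℝ^d`. -/
def latticeSet (d : ℕ) : Set (Fin d → ℝ) := Set.range (intVec (d := d))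

/-- Two subsets of `ℝ^d` are lattice-equivalent if some affine bijection of `ℝ^d`
preserving `ℤ^d` maps one onto the other. -/
def LatticeEquiv (d : ℕ) (P₁ P₂ : Set (Fin d → ℝ)) : Prop :=
  ∃ σ : (Fin d → ℝ) ≃ᵃ[ℝ] (Fin d → ℝ), σ '' latticeSet d = latticeSet d ∧ P₂ = σ '' P₁

/-- The type of equivalence classes of `d`-dimensional convex lattice polytopes
satisfying the predicate `Q`, modulo lattice equivalence. -/
def ClassesType (d : ℕ) (Q : Set (Fin d → ℝ) → Prop) : Type :=
  Quot (fun P₁ P₂ : {P : Set (Fin d → ℝ) // IsConvexLatticePolytope d P ∧ IsFullDim d P ∧ Q P} =>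
    LatticeEquiv d P₁.1 P₂.1)

/-- `P` is centrally symmetric (with some center `c`, i.e. `P = 2c - P`). -/
def IsCentrallySymmetric (d : ℕ) (P : Set (Fin d → ℝ)) : Prop :=
  ∃ c : Fin d → ℝ, ∀ x, x ∈ P ↔ (2 : ℝ) • c - x ∈ P

/-- `κ(2,w)`: the number of equivalence classes of convex lattice polygons with
exactly `w` lattice points. -/
def kappaTwo (w : ℕ) : ℕ :=
  Nat.card (ClassesType 2 (fun P => (latticePts 2 P).ncard = w))

def reps : ℕ → List (List (ℤ × ℤ) × List (ℤ × ℤ × ℤ))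
  | 3 => [
    ([(0, 0), (0, 1), (1, 0)],
      [(0, 1, 0), (1, 0, 0), (-1, -1, 1)])]
  | 4 => [
    ([(-1, -1), (0, 0), (0, 1), (1, 0)],
      [(-1, 2, 1), (2, -1, 1), (-1, -1, 1)]),
    ([(-1, 0), (0, 0), (0, 1), (1, 0)],
      [(0, 1, 0), (1, -1, 1), (-1, -1, 1)]),
    ([(0, 0), (0, 1), (1, 0), (1, 1)],
      [(0, 1, 0), (1, 0, 0), (-1, 0, 1), (0, -1, 1)])]
  | 5 => [
    ([(-3, -1), (-1, 0), (0, 0), (0, 1), (1, 0)],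
      [(-1, 4, 1), (2, -3, 3), (-1, -1, 1)]),
    ([(-1, -1), (-1, 0), (0, 0), (0, 1), (1, 0)],
      [(-1, 2, 1), (1, 0, 1), (1, -1, 1), (-1, -1, 1)]),
    ([(0, -1), (0, 0), (0, 1), (1, 0), (2, 0)],
      [(-1, 2, 2), (1, 0, 0), (-1, -2, 2)]),
    ([(-2, 0), (-1, 0), (0, 0), (0, 1), (1, 0)],
      [(0, 1, 0), (1, -2, 2), (-1, -1, 1)]),
    ([(-1, 0), (-1, 1), (0, 0), (0, 1), (1, 0)],
      [(0, 1, 0), (1, 0, 1), (0, -1, 1), (-1, -1, 1)]),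
    ([(-1, 0), (0, -1), (0, 0), (0, 1), (1, 0)],
      [(1, 1, 1), (-1, 1, 1), (1, -1, 1), (-1, -1, 1)])]
  | 6 => [
    ([(-2, -1), (-1, 0), (-1, 1), (0, 0), (0, 1), (1, 0)],
      [(-1, 3, 1), (2, -1, 3), (0, -1, 1), (-1, -1, 1)]),
    ([(-2, 0), (-1, 0), (0, 0), (0, 1), (1, -1), (1, 0)],
      [(1, 3, 2), (1, -2, 2), (-1, 0, 1), (-1, -1, 1)]),
    ([(-3, -1), (-1, 0), (0, 0), (0, 1), (1, 0), (2, 0)],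
      [(-1, 5, 2), (2, -3, 3), (-1, -2, 2)]),
    ([(-1, -1), (-1, 0), (-1, 1), (0, 0), (0, 1), (1, 0)],
      [(-1, 2, 1), (1, 0, 1), (0, -1, 1), (-1, -1, 1)]),
    ([(-2, 0), (-1, -1), (-1, 0), (0, 0), (0, 1), (1, 0)],
      [(1, 1, 2), (-1, 2, 1), (1, -2, 2), (-1, -1, 1)]),
    ([(-1, -1), (-1, 0), (0, -1), (0, 0), (0, 1), (1, 0)],
      [(0, 1, 1), (1, 0, 1), (-1, 1, 1), (1, -1, 1), (-1, -1, 1)]),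
    ([(-2, -1), (-1, 0), (0, 0), (0, 1), (0, 2), (1, 0)],
      [(-1, 3, 1), (3, -2, 4), (-2, -1, 2)]),
    ([(-2, -1), (-2, 0), (-1, 0), (0, 0), (0, 1), (1, 0)],
      [(-1, 3, 1), (1, 0, 2), (1, -2, 2), (-1, -1, 1)]),
    ([(-2, -1), (-1, 0), (0, 0), (0, 1), (1, 0), (2, 0)],
      [(-1, 4, 2), (1, -1, 1), (-1, -2, 2)]),
    ([(-2, 0), (-1, 0), (0, 0), (0, 1), (1, 0), (2, 0)],
      [(0, 1, 0), (1, -2, 2), (-1, -2, 2)]),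
    ([(-2, 0), (-1, 0), (-1, 1), (0, 0), (0, 1), (1, 0)],
      [(0, 1, 0), (1, -1, 2), (0, -1, 1), (-1, -1, 1)]),
    ([(-1, 0), (-1, 1), (0, 0), (0, 1), (1, 0), (1, 1)],
      [(0, 1, 0), (1, 0, 1), (0, -1, 1), (-1, 0, 1)]),
    ([(-1, 1), (0, 0), (0, 1), (1, -1), (1, 0), (1, 1)],
      [(1, 1, 0), (0, -1, 1), (-1, 0, 1)])]
  | 7 => [
    ([(-2, -1), (-2, 0), (-1, 0), (-1, 1), (0, 0), (0, 1), (1, 0)],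
      [(-1, 3, 1), (1, 0, 2), (1, -1, 2), (0, -1, 1), (-1, -1, 1)]),
    ([(-2, -1), (-1, -1), (-1, 0), (-1, 1), (0, 0), (0, 1), (1, 0)],
      [(0, 1, 1), (-1, 2, 1), (2, -1, 3), (0, -1, 1), (-1, -1, 1)]),
    ([(-1, 1), (0, 0), (0, 1), (1, -1), (1, 0), (1, 1), (2, 2)],
      [(1, 1, 0), (-3, 1, 4), (1, -3, 4)]),
    ([(-2, -2), (-1, -1), (-1, 0), (-1, 1), (0, 0), (0, 1), (1, 0)],
      [(-2, 3, 2), (3, -1, 4), (0, -1, 1), (-1, -1, 1)]),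
    ([(-2, -1), (-1, 0), (-1, 1), (0, 0), (0, 1), (1, 0), (1, 1)],
      [(-1, 3, 1), (2, -1, 3), (0, -1, 1), (-1, 0, 1)]),
    ([(-3, -1), (-1, 0), (0, 0), (0, 1), (1, 0), (1, 1), (2, 0)],
      [(-1, 5, 2), (2, -3, 3), (0, -1, 1), (-1, -1, 2)]),
    ([(-3, -1), (-2, 0), (-1, 0), (0, 0), (0, 1), (1, 0), (2, 0)],
      [(-1, 5, 2), (1, -1, 2), (1, -2, 2), (-1, -2, 2)]),
    ([(-2, -1), (-1, 0), (0, 0), (0, 1), (1, 0), (1, 1), (2, 0)],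
      [(-1, 4, 2), (1, -1, 1), (0, -1, 1), (-1, -1, 2)]),
    ([(-2, 0), (-1, -1), (-1, 0), (0, 0), (0, 1), (1, 0), (2, 0)],
      [(1, 1, 2), (-1, 3, 2), (1, -2, 2), (-1, -2, 2)]),
    ([(-3, -1), (-1, 0), (0, 0), (0, 1), (1, 0), (2, 0), (3, 0)],
      [(-1, 6, 3), (2, -3, 3), (-1, -3, 3)]),
    ([(-2, -1), (-2, 0), (-1, -1), (-1, 0), (0, 0), (0, 1), (1, 0)],
      [(0, 1, 1), (1, 0, 2), (-1, 2, 1), (1, -2, 2), (-1, -1, 1)]),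
    ([(-1, 1), (0, 0), (0, 1), (1, -1), (1, 0), (1, 1), (2, 1)],
      [(1, 1, 0), (0, -1, 1), (-2, 1, 3)]),
    ([(-1, -1), (-1, 0), (-1, 1), (0, -1), (0, 0), (0, 1), (1, 0)],
      [(0, 1, 1), (1, 0, 1), (-1, 1, 1), (0, -1, 1), (-1, -1, 1)]),
    ([(-1, -1), (-1, 0), (-1, 1), (0, 0), (0, 1), (1, 0), (1, 1)],
      [(-1, 2, 1), (1, 0, 1), (0, -1, 1), (-1, 0, 1)]),
    ([(-1, -1), (-1, 0), (0, -1), (0, 0), (0, 1), (1, 0), (1, 1)],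
      [(0, 1, 1), (1, 0, 1), (-1, 1, 1), (1, -1, 1), (-1, 0, 1), (0, -1, 1)]),
    ([(-2, 0), (-1, 0), (0, -1), (0, 0), (0, 1), (1, 0), (2, 0)],
      [(1, 2, 2), (-1, 2, 2), (1, -2, 2), (-1, -2, 2)]),
    ([(-2, -1), (-2, 0), (-1, 0), (0, 0), (0, 1), (1, 0), (2, 0)],
      [(-1, 4, 2), (1, 0, 2), (1, -2, 2), (-1, -2, 2)]),
    ([(-3, 0), (-2, 0), (-1, 0), (0, 0), (0, 1), (1, 0), (2, -1)],
      [(1, 5, 3), (1, -3, 3), (-1, -1, 1)]),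
    ([(-3, 0), (-2, 0), (-1, 0), (0, 0), (0, 1), (1, 0), (2, 0)],
      [(0, 1, 0), (1, -3, 3), (-1, -2, 2)]),
    ([(-2, 0), (-1, 0), (-1, 1), (0, 0), (0, 1), (1, 0), (2, 0)],
      [(0, 1, 0), (1, -1, 2), (0, -1, 1), (-1, -2, 2)]),
    ([(-2, 0), (-2, 1), (-1, 0), (-1, 1), (0, 0), (0, 1), (1, 0)],
      [(0, 1, 0), (1, 0, 2), (0, -1, 1), (-1, -1, 1)])]
  | _ => []

def hints : ℕ → List (List (ℤ × ℤ × ℕ × ℤ × ℤ × ℤ × ℤ × ℤ × ℤ))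
  | 3 => [
    [(-1, -1, 0, 0, 0, 0, 1, 1, 0), (-1, 0, 1, 0, 0, 1, 0, 0, 1), (-1, 1, 2, 0, 0, 1, 0, -1, 1),
      (-1, 2, 1, 0, 1, 1, 0, 0, 0), (-1, 3, 0, 0, 1, 0, 0, 1, 0), (0, -1, 1, 0, 0, 0, 1, 1, 0),
      (0, 2, 1, 0, 1, 0, 0, 1, 0), (1, -1, 2, 0, 0, 0, 1, 1, -1), (1, 1, 2, 0, 0, 0, 1, 1, 0),
      (2, -1, 1, 1, 0, 0, 1, 0, 0), (2, 0, 1, 1, 0, 0, 0, 0, 1), (3, -1, 0, 1, 0, 0, 0, 0, 1)]]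
  | 4 => [
    [(-2, -2, 0, -1, -1, -2, -2, 0, 1), (-1, 0, 1, 0, 0, 1, 0, -1, -1), (0, -1, 1, 0, 0, 0, 1, -1, -1),
      (0, 2, 0, 0, 1, 0, 2, -1, -1), (1, 1, 1, 0, 0, -1, -1, 0, 1), (2, 0, 0, 1, 0, 2, 0, -1, -1)],
    [(-3, -1, 0, 0, 0, 1, 0, 0, 1), (-2, -1, 2, -1, 0, 0, 0, 0, 1), (-2, 0, 3, -1, 0, -2, 0, 0, 1),
      (-1, -1, 1, 0, 0, 1, 0, 0, 1), (-1, 1, 4, 0, 0, -1, 0, -1, 1), (0, -1, 5, 0, 0, -1, 0, 0, 1),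
      (0, 2, 2, 0, 0, 0, 1, -1, 0), (1, -1, 1, 0, 0, -1, 0, 0, 1), (1, 1, 4, 0, 0, -1, 0, 0, 1),
      (2, -1, 2, 1, 0, 0, 0, 0, 1), (2, 0, 3, 0, 0, -1, 0, 0, 1), (3, -1, 0, 0, 0, -1, 0, 0, 1)],
    [(-1, -1, 1, 0, 0, -1, -1, 0, 1), (-1, 0, 4, 0, 0, 1, 0, 1, 1), (-1, 1, 4, 0, 1, 1, 1, 1, 0),
      (-1, 2, 1, 0, 1, -1, 2, 0, 0), (0, -1, 4, 0, 0, 0, 1, 1, 1), (0, 2, 4, 0, 1, 0, 0, 1, 0),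
      (1, -1, 4, 1, 0, 1, 1, 0, 1), (1, 2, 4, 1, 1, 1, 0, 0, 0), (2, -1, 1, 1, 0, 2, -1, 0, 0),
      (2, 0, 4, 1, 0, 0, 0, 0, 1), (2, 1, 4, 1, 1, 0, 1, 0, 0), (2, 2, 1, 1, 1, 2, 2, 0, 1)]]
  | 5 => [
    [(-2, -1, 0, 0, 0, 1, 0, -2, -1), (-2, 0, 1, -1, 0, -2, 0, -3, -1), (1, 1, 0, 0, 0, 1, 0, 1, 1),
      (2, 0, 2, 0, 0, 1, 0, -3, -1)],
    [(-2, -2, 0, -1, -1, -2, -2, -1, 0), (-2, -1, 3, 0, 0, 1, 0, -1, -1), (-2, 0, 4, -1, 0, -2, 0, -1, -1),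
      (-1, 1, 3, 0, 0, 1, 0, 0, 1), (0, -1, 5, 0, 0, 0, 1, 1, 0), (0, 2, 0, 0, 1, 0, 2, -1, 0),
      (1, 1, 5, 0, 0, -1, -1, 1, 0), (2, 0, 1, 0, 0, -1, 0, -1, -1)],
    [(-1, -2, 6, 0, -1, -1, -2, 0, 0), (-1, -1, 0, 1, 0, 2, 0, 0, -1), (-1, 0, 7, 1, 0, 2, 0, 0, -1),
      (-1, 1, 0, 1, 0, 2, 0, 0, 1), (-1, 2, 6, 0, 0, 0, -1, 1, 0), (1, -1, 3, 1, 0, 2, 0, 1, -1),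
      (1, 1, 3, 1, 0, 2, 0, 1, 1), (3, 0, 8, 1, 0, 2, 0, 0, -1)],
    [(-5, -1, 2, -1, 0, 0, 0, 0, 1), (-4, -1, 8, -1, 0, 0, 0, 0, 1), (-3, -1, 1, -1, 0, -2, 0, 0, 1),
      (-3, 0, 9, -1, 0, -2, 0, 0, 1), (-2, -1, 7, 0, 0, 1, 0, 0, 1), (-1, -1, 4, -1, 0, -2, 0, 0, 1),
      (-1, 1, 10, -1, 0, -2, 0, -1, 1), (0, -1, 7, -1, 0, -2, 0, 0, 1), (1, -1, 1, 0, 0, 1, 0, 0, 1),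
      (1, 1, 10, -1, 0, -2, 0, 0, 1), (2, -1, 8, 0, 0, -1, 0, 0, 1), (2, 0, 9, 0, 0, -1, 0, 0, 1),
      (3, -1, 2, 0, 0, -1, 0, 0, 1)],
    [(-2, -1, 0, 0, 0, 1, 0, 0, 1), (-2, 0, 10, -1, 0, -2, 0, -1, 1), (-2, 1, 11, -1, 1, 0, 1, 0, 0),
      (-2, 2, 3, -1, 1, -2, 2, 0, 1), (-1, -1, 3, 0, 0, 1, 0, 0, 1), (-1, 2, 12, -1, 1, 0, 0, 0, 1),
      (0, -1, 5, 0, 0, 1, 0, 0, -1), (0, 2, 3, 0, 1, 0, 2, -1, 1), (1, -1, 5, 0, 0, -1, 0, 1, -1),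
      (1, 1, 11, 0, 0, -1, 0, 0, 1), (2, -1, 3, 0, 0, -1, 0, -1, 1), (2, 0, 10, 0, 0, -1, 0, -1, 1),
      (3, -1, 0, 0, 0, -1, 0, -1, 1)],
    [(-2, 0, 7, -1, 0, -2, 0, 0, -1), (-1, -1, 5, 0, 0, 0, 1, 1, 0), (-1, 1, 5, 0, 0, 0, -1, 1, 0),
      (0, -2, 7, 0, -1, 0, -2, -1, 0), (0, 2, 7, 0, 1, 0, 2, -1, 0), (1, -1, 5, 0, 0, -1, 0, 0, 1),
      (1, 1, 5, 0, 0, -1, 0, 0, -1), (2, 0, 7, 1, 0, 2, 0, 0, -1)]]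
  | 6 => [
    [(-2, 0, 0, 0, 0, 1, 0, 0, 1), (-1, -1, 1, 0, 0, 1, 0, 0, 1), (-1, 2, 2, 0, 1, -1, 1, 0, 0),
      (0, 2, 3, -1, 0, -2, -1, -1, 1), (1, 1, 4, 0, 0, 1, 0, 0, 1), (2, 0, 5, 0, 0, 1, 0, -1, 1)],
    [(-3, 0, 6, -1, 0, -2, 0, 0, 1), (-1, 1, 0, -1, 0, -2, 0, -1, 1), (0, -1, 0, -1, 0, -2, 0, 0, -1),
      (1, 1, 7, 0, 0, -1, 0, 1, 1), (2, -1, 7, 0, 0, -1, 0, 2, -1), (2, 0, 8, 0, 0, -1, 0, 0, 1)],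
    [(-2, -1, 5, 0, 0, 1, 0, -3, -1), (-2, 0, 6, 0, 0, 1, 0, -3, -1), (1, 1, 5, 0, 0, 1, 0, 0, 1),
      (3, 0, 9, 0, 0, 1, 0, -3, -1)],
    [(-2, -2, 3, 0, 0, 1, 0, 0, 1), (-2, -1, 1, 0, 0, 1, 0, -1, -1), (-2, 0, 10, 0, 0, 1, 0, -1, -1),
      (-2, 1, 4, 0, 0, 1, 0, -1, 1), (-2, 2, 3, -1, 1, -2, 2, 0, 1), (-1, 2, 11, 0, 1, 0, 0, -1, 1),
      (0, -1, 12, 0, 0, 1, 0, 0, 1), (0, 2, 4, 0, 1, 0, 2, -1, 0), (1, 1, 13, 0, 0, 1, 0, 0, 1),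
      (2, 0, 7, 0, 0, 1, 0, -1, 1)],
    [(-3, 0, 8, -1, 0, -2, 0, -1, -1), (-2, -1, 10, 0, 0, 1, 0, 0, 1), (-1, 1, 10, 0, 0, 1, 0, -1, -1),
      (0, -1, 10, -1, 0, -2, 0, 0, 1), (1, 1, 10, -1, 0, -2, 0, -1, -1), (2, 0, 8, 0, 0, 1, 0, -1, -1)],
    [(-2, -2, 1, -1, -1, -2, -2, -1, 0), (-2, -1, 13, 0, 0, 1, 0, -1, -1), (-2, 0, 10, -1, 0, -2, 0, 0, 1),
      (-1, -2, 13, 0, 0, 0, 1, -1, -1), (-1, 1, 12, 0, 0, 1, 0, 0, -1), (0, -2, 10, 0, -1, 0, -2, 1, 0),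
      (0, 2, 0, 0, 1, 0, 2, -1, 0), (1, -1, 12, 0, 0, 0, 1, -1, 0), (1, 1, 14, 0, 0, -1, -1, 0, 1),
      (2, 0, 0, 1, 0, 2, 0, 0, -1)],
    [(-1, -1, 3, 0, 0, 1, 0, -1, -1), (-1, 1, 3, -1, 0, -2, -1, -1, 1), (1, 1, 3, 0, 1, 0, 2, 1, 1)],
    [(-3, -1, 0, 0, 0, 1, 0, -2, -1), (-3, 0, 15, -1, 0, -2, 0, -2, -1), (-1, -1, 10, 0, 0, 1, 0, 0, 1),
      (-1, 1, 0, 0, 0, 1, 0, 0, 1), (1, 1, 10, 0, 0, 1, 0, -2, -1), (2, 0, 16, 0, 0, 1, 0, -2, -1)],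
    [(-3, -1, 5, 0, 0, 1, 0, -3, -1), (-2, 0, 16, 0, 0, 1, 0, -2, -1), (-1, -1, 7, 0, 0, 1, 0, -2, -1),
      (-1, 1, 5, 0, 0, 1, 0, -1, 1), (1, 1, 7, 0, 0, 1, 0, 0, 1), (3, 0, 17, 0, 0, -1, 0, -2, -1)],
    [(-5, -1, 9, -1, 0, 0, 0, 0, 1), (-4, -1, 17, -1, 0, -2, 0, 0, 1), (-3, -1, 6, 0, 0, 1, 0, 0, 1),
      (-3, 0, 18, -1, 0, -2, 0, 0, 1), (-2, -1, 16, 0, 0, 1, 0, 0, 1), (-1, -1, 8, 0, 0, 1, 0, 0, 1),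
      (-1, 1, 19, 0, 0, -1, 0, -1, 1), (0, -1, 15, 0, 0, -1, 0, 0, 1), (1, -1, 8, 0, 0, -1, 0, 0, 1),
      (1, 1, 19, 0, 0, -1, 0, 0, 1), (2, -1, 16, 0, 0, -1, 0, 0, 1), (3, -1, 6, 0, 0, -1, 0, 0, 1),
      (3, 0, 18, 0, 0, -1, 0, 0, 1), (4, -1, 17, 1, 0, 2, 0, 0, 1), (5, -1, 9, 1, 0, 0, 0, 0, 1)],
    [(-4, -1, 5, -1, 0, 0, 0, -1, 1), (-3, -1, 7, -1, 0, 0, 0, -1, 1), (-3, 0, 19, -1, 0, -2, 0, -1, 1),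
      (-2, -1, 0, 0, 0, 1, 0, 0, 1), (-2, 1, 20, -1, 0, -2, 0, -2, 1), (-1, -1, 10, 0, 0, 1, 0, -1, -1),
      (-1, 2, 11, 0, 1, -1, 1, 0, 0), (0, -1, 10, -1, 0, -2, 0, 0, -1), (0, 2, 11, -1, 1, 0, 1, -1, 0),
      (1, -1, 0, -1, 0, -2, 0, -1, 1), (1, 1, 20, -1, 0, -2, 0, -1, 1), (2, -1, 7, 0, 0, -1, 0, 0, 1),
      (2, 0, 19, 0, 0, -1, 0, -1, 1), (3, -1, 5, 0, 0, -1, 0, 0, 1)],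
    [(-2, -1, 4, 0, 0, 1, 0, 0, 1), (-2, 0, 20, -1, 0, -2, 0, -1, 1), (-2, 1, 20, -1, 1, -2, 1, -1, 0),
      (-2, 2, 4, 0, 1, 1, 1, 0, 0), (-1, -1, 13, 0, 0, 1, 0, 0, 1), (-1, 2, 13, 0, 1, 1, 1, 0, 0),
      (0, -1, 12, 0, 0, 0, -1, -1, 0), (0, 2, 12, 0, 1, 0, 2, -1, 1), (1, -1, 13, 0, 0, -1, 0, 0, 1),
      (1, 2, 13, 0, 1, -1, 1, 0, 0), (2, -1, 4, 0, 0, -1, 0, 0, 1), (2, 0, 20, 0, 0, -1, 0, -1, 1),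
      (2, 1, 20, 0, 1, -1, 1, -1, 0), (2, 2, 4, 0, 1, -1, 1, 0, 0)],
    [(-3, 2, 2, 1, 0, 0, 0, 0, 1), (-2, 1, 11, 1, 0, 0, 0, 0, 1), (-2, 2, 11, 1, 0, 0, 1, 0, 0),
      (-1, 0, 13, 0, 0, -1, 0, 0, 1), (-1, 2, 13, 0, 1, -1, 2, 0, 0), (0, -1, 13, 0, 0, 0, -1, 1, 0),
      (0, 2, 13, 0, 1, 0, 2, 1, 0), (1, -2, 11, 0, 1, 0, 0, 1, 0), (1, 2, 11, 0, 0, 0, 1, 1, 0),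
      (2, -3, 2, 0, 1, 0, 0, 1, 0), (2, -2, 11, 0, 1, 1, 0, 0, 0), (2, -1, 13, 1, 0, 2, -1, 0, 0),
      (2, 0, 13, 1, 0, 2, 0, 0, 1), (2, 1, 11, 0, 0, 1, 0, 0, 1), (2, 2, 2, 0, 0, 0, 1, 1, 0)]]
  | _ => []

def dt (a b c : ℤ × ℤ) : ℤ := (b.1 - a.1) * (c.2 - a.2) - (b.2 - a.2) * (c.1 - a.1)

def amap (a b c p : ℤ × ℤ) : ℤ × ℤ :=
  (a.1 + p.1 * (b.1 - a.1) + p.2 * (c.1 - a.1), a.2 + p.1 * (b.2 - a.2) + p.2 * (c.2 - a.2))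

def hv (e : ℤ × ℤ × ℤ) (p : ℤ × ℤ) : ℤ := e.1 * p.1 + e.2.1 * p.2 + e.2.2

def mem? (R : List (ℤ × ℤ)) (p : ℤ × ℤ) : Bool :=
  R.any fun q => decide (q.1 = p.1) && decide (q.2 = p.2)

def okE (R : List (ℤ × ℤ)) (e : ℤ × ℤ × ℤ) : Bool :=
  decide (Int.gcd e.1 e.2.1 = 1) && (R.all fun p => decide (0 ≤ hv e p)) &&
    R.any fun a => decide (hv e a = 0) && mem? R (a.1 + e.2.1, a.2 - e.1)

def bddE (E : List (ℤ × ℤ × ℤ)) (u1 u2 B : ℤ) : Bool :=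
  E.any fun e => E.any fun f =>
    decide (0 < e.1 * f.2.1 - f.1 * e.2.1) &&
    decide (0 ≤ u2 * f.1 - u1 * f.2.1) && decide (0 ≤ u1 * e.2.1 - e.1 * u2) &&
    decide ((u2 * f.1 - u1 * f.2.1) * (1 + e.2.2) + (u1 * e.2.1 - e.1 * u2) * (1 + f.2.2) <
      (e.1 * f.2.1 - f.1 * e.2.1) * (B + 1))

def rangeX : List ℤ := [-7, -6, -5, -4, -3, -2, -1, 0, 1, 2, 3, 4, 5, 6, 7]
def rangeY : List ℤ := [-3, -2, -1, 0, 1, 2, 3]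

def okIn (R : List (ℤ × ℤ)) (E : List (ℤ × ℤ × ℤ)) : Bool :=
  rangeX.all fun x => rangeY.all fun y =>
    (E.any fun e => decide (hv e (x, y) < 0)) || mem? R (x, y)

def nodup? : List (ℤ × ℤ) → Bool
  | [] => true
  | a :: l => !(mem? l a) && nodup? l

def okRep (n : ℕ) (r : List (ℤ × ℤ) × List (ℤ × ℤ × ℤ)) : Bool :=
  decide (r.1.length = n) && nodup? r.1 &&
  mem? r.1 (0, 0) && mem? r.1 (1, 0) && mem? r.1 (0, 1) &&
  (r.2.all (okE r.1)) &&
  bddE r.2 1 0 7 && bddE r.2 (-1) 0 7 && bddE r.2 0 1 3 && bddE r.2 0 (-1) 3 &&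
  okIn r.1 r.2

def sumL (l : List (ℤ × ℤ)) (f : ℤ × ℤ → ℕ) : ℕ := (l.map f).sum

def sigL (R : List (ℤ × ℤ)) : ℕ :=
  sumL R fun a => (sumL R fun b => sumL R fun c => (dt a b c).natAbs) ^ 2

def matchL (T R : List (ℤ × ℤ)) (a b c : ℤ × ℤ) : Bool :=
  decide ((dt a b c).natAbs = 1) && R.all fun p => mem? T (amap a b c p)

def okHint (n : ℕ) (R : List (ℤ × ℤ)) (x y : ℤ)
    (h : ℤ × ℤ × ℕ × ℤ × ℤ × ℤ × ℤ × ℤ × ℤ) : Bool :=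
  match h with
  | (u, v, j, a1, a2, b1, b2, c1, c2) =>
    decide (u = x) && decide (v = y) &&
      match (reps n)[j]? with
      | none => false
      | some r => matchL ((x, y) :: R) r.1 (a1, a2) (b1, b2) (c1, c2)

def stepOK (n : ℕ) (r : List (ℤ × ℤ) × List (ℤ × ℤ × ℤ))
    (hs : List (ℤ × ℤ × ℕ × ℤ × ℤ × ℤ × ℤ × ℤ × ℤ)) : Bool :=
  rangeX.all fun x => rangeY.all fun y =>
    (r.2.any fun e => decide (hv e (x, y) < -1)) || mem? r.1 (x, y) ||
      hs.any (okHint (n + 1) r.1 x y)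

def stepAll (n : ℕ) : List (List (ℤ × ℤ) × List (ℤ × ℤ × ℤ)) →
    List (List (ℤ × ℤ × ℕ × ℤ × ℤ × ℤ × ℤ × ℤ × ℤ)) → Bool
  | [], _ => true
  | _ :: _, [] => false
  | r :: rs, h :: hs => stepOK n r h && stepAll n rs hs

theorem reps_ok3 : (reps 3).all (okRep 3) = true := by decide +kernel
theorem reps_ok4 : (reps 4).all (okRep 4) = true := by decide +kernel
theorem reps_ok5 : (reps 5).all (okRep 5) = true := by decide +kernel
theorem reps_ok6 : (reps 6).all (okRep 6) = true := by decide +kernel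
theorem reps_ok7 : (reps 7).all (okRep 7) = true := by decide +kernel
theorem step_ok3 : stepAll 3 (reps 3) (hints 3) = true := by decide +kernel
theorem step_ok4 : stepAll 4 (reps 4) (hints 4) = true := by decide +kernel
theorem step_ok5 : stepAll 5 (reps 5) (hints 5) = true := by decide +kernel
theorem step_ok6 : stepAll 6 (reps 6) (hints 6) = true := by decide +kernel
theorem sig_ok : ∀ n ∈ [3, 4, 5, 6, 7], ((reps n).map fun r => sigL r.1).Nodup := by decide +kernel

theorem mem?_iff {R : List (ℤ × ℤ)} {p : ℤ × ℤ} : mem? R p = true ↔ p ∈ R := by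
  simp only [mem?, List.any_eq_true, Bool.and_eq_true, decide_eq_true_eq]
  constructor
  · rintro ⟨q, hq, h1, h2⟩
    have : q = p := Prod.ext h1 h2
    exact this ▸ hq
  · intro h; exact ⟨p, h, rfl, rfl⟩

theorem nodup?_iff {R : List (ℤ × ℤ)} (h : nodup? R = true) : R.Nodup := by
  induction R with
  | nil => simp
  | cons a l ih =>
    simp only [nodup?, Bool.and_eq_true, Bool.not_eq_true'] at h
    refine List.nodup_cons.2 ⟨fun hm => ?_, ih h.2⟩
    rw [mem?_iff.2 hm] at h
    simp at h

theorem dt_amap (a b c p q r : ℤ × ℤ) :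
    dt (amap a b c p) (amap a b c q) (amap a b c r) = dt a b c * dt p q r := by
  simp only [dt, amap]; ring

theorem amap_comp (a b c p q r x : ℤ × ℤ) :
    amap a b c (amap p q r x) = amap (amap a b c p) (amap a b c q) (amap a b c r) x := by
  simp only [amap]; ext <;> simp <;> ring

theorem natAbs_one_sq {e : ℤ} (h : e.natAbs = 1) : e * e = 1 := by
  rcases Int.natAbs_eq_iff.1 h with h | h <;> simp [h]

theorem amap_inj {a b c : ℤ × ℤ} (h : (dt a b c).natAbs = 1) : Function.Injective (amap a b c) := by
  intro p q hpq
  have h2 := natAbs_one_sq h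
  have e1 : (a.1 + p.1 * (b.1 - a.1) + p.2 * (c.1 - a.1)) = (a.1 + q.1 * (b.1 - a.1) + q.2 * (c.1 - a.1)) :=
    congrArg Prod.fst hpq
  have e2 : (a.2 + p.1 * (b.2 - a.2) + p.2 * (c.2 - a.2)) = (a.2 + q.1 * (b.2 - a.2) + q.2 * (c.2 - a.2)) :=
    congrArg Prod.snd hpq
  have k1 : dt a b c * (p.1 - q.1) = 0 := by
    simp only [dt]; linear_combination (c.2 - a.2) * e1 - (c.1 - a.1) * e2
  have k2 : dt a b c * (p.2 - q.2) = 0 := by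
    simp only [dt]; linear_combination (b.1 - a.1) * e2 - (b.2 - a.2) * e1
  ext
  · linear_combination dt a b c * k1 - (p.1 - q.1) * h2
  · linear_combination dt a b c * k2 - (p.2 - q.2) * h2

theorem amap_surj {a b c : ℤ × ℤ} (h : (dt a b c).natAbs = 1) (v : ℤ × ℤ) :
    ∃ w, amap a b c w = v := by
  have h2 := natAbs_one_sq h
  refine ⟨(dt a b c * dt a v c, dt a b c * dt a b v), ?_⟩
  ext
  · simp only [amap]
    simp only [dt] at h2 ⊢
    linear_combination (v.1 - a.1) * h2
  · simp only [amap]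
    simp only [dt] at h2 ⊢
    linear_combination (v.2 - a.2) * h2

/-- closed under lattice points of triangles -/
def TriClosed (S : Finset (ℤ × ℤ)) : Prop :=
  ∀ a ∈ S, ∀ b ∈ S, ∀ c ∈ S, ∀ p : ℤ × ℤ, ∀ s t u : ℤ, 0 ≤ s → 0 ≤ t → 0 ≤ u → 0 < s + t + u →
    (s + t + u) * p.1 = s * a.1 + t * b.1 + u * c.1 →
    (s + t + u) * p.2 = s * a.2 + t * b.2 + u * c.2 → p ∈ S

def NonCol (S : Finset (ℤ × ℤ)) : Prop :=
  ∃ a ∈ S, ∃ b ∈ S, ∃ c ∈ S, dt a b c ≠ 0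

theorem visible {S : Finset (ℤ × ℤ)} (hS : TriClosed S) {a b w : ℤ × ℤ} (ha : a ∈ S) (hb : b ∈ S)
    (hw : w ∈ S) (hg : Int.gcd (b.1 - a.1) (b.2 - a.2) = 1) (hd : dt a b w < 0) :
    ∃ p ∈ S, dt a b p = -1 := by
  obtain ⟨D, hD⟩ : ∃ D, D = - dt a b w := ⟨_, rfl⟩
  have hD0 : 0 < D := by omega
  have hbz := Int.gcd_eq_gcd_ab (b.1 - a.1) (b.2 - a.2)
  rw [hg] at hbz
  set m := Int.gcdA (b.1 - a.1) (b.2 - a.2)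
  set n := Int.gcdB (b.1 - a.1) (b.2 - a.2)
  push_cast at hbz
  obtain ⟨s0, hs0⟩ : ∃ s0, s0 = -(m * (w.1 - a.1) + n * (w.2 - a.2)) := ⟨_, rfl⟩
  obtain ⟨q, s, hs, hs1, hs2⟩ : ∃ q s : ℤ, s0 = D * q + s ∧ 0 ≤ s ∧ s < D :=
    ⟨s0 / D, s0 % D, (Int.mul_ediv_add_emod s0 D).symm, Int.emod_nonneg _ hD0.ne', Int.emod_lt_of_pos _ hD0⟩
  simp only [dt] at hD
  -- D * p = (D-1-s) a + s b + w = D a + (w - a) + s (b-a)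
  have k1 : (D - 1 - s + s + 1) * (a.1 + n - q * (b.1 - a.1)) = (D - 1 - s) * a.1 + s * b.1 + 1 * w.1 := by
    have : s = s0 - D * q := by omega
    rw [this, hs0]
    linear_combination n * hD - (w.1 - a.1) * hbz
  have k2 : (D - 1 - s + s + 1) * (a.2 - m - q * (b.2 - a.2)) = (D - 1 - s) * a.2 + s * b.2 + 1 * w.2 := by
    have : s = s0 - D * q := by omega
    rw [this, hs0]
    linear_combination -m * hD - (w.2 - a.2) * hbz
  refine ⟨(a.1 + n - q * (b.1 - a.1), a.2 - m - q * (b.2 - a.2)),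
    hS a ha b hb w hw _ (D - 1 - s) s 1 (by omega) hs1 (by omega) (by omega) k1 k2, ?_⟩
  simp only [dt]
  linear_combination hbz

theorem erase_triClosed {S : Finset (ℤ × ℤ)} (hS : TriClosed S) (v : ℤ × ℤ) (A B : ℤ)
    (hf : ∀ p ∈ S, p ≠ v → A * p.1 + B * p.2 < A * v.1 + B * v.2) : TriClosed (S.erase v) := by
  intro a ha b hb c hc p s t u hs ht hu hpos h1 h2
  rw [Finset.mem_erase] at ha hb hc ⊢
  refine ⟨?_, hS a ha.2 b hb.2 c hc.2 p s t u hs ht hu hpos h1 h2⟩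
  rintro rfl
  have fa := hf a ha.2 ha.1
  have fb := hf b hb.2 hb.1
  have fc := hf c hc.2 hc.1
  have key : s * (A * p.1 + B * p.2 - (A * a.1 + B * a.2)) + t * (A * p.1 + B * p.2 - (A * b.1 + B * b.2))
     + u * (A * p.1 + B * p.2 - (A * c.1 + B * c.2)) = 0 := by
    linear_combination A * h1 + B * h2
  have g1 : s ≤ s * (A * p.1 + B * p.2 - (A * a.1 + B * a.2)) := le_mul_of_one_le_right hs (by omega)
  have g2 : t ≤ t * (A * p.1 + B * p.2 - (A * b.1 + B * b.2)) := le_mul_of_one_le_right ht (by omega)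
  have g3 : u ≤ u * (A * p.1 + B * p.2 - (A * c.1 + B * c.2)) := le_mul_of_one_le_right hu (by omega)
  linarith

theorem col_of_line {p q a b c : ℤ × ℤ} (hpq : p ≠ q) (ha : dt p q a = 0) (hb : dt p q b = 0)
    (hc : dt p q c = 0) : dt a b c = 0 := by
  simp only [dt] at *
  have h : q.1 - p.1 ≠ 0 ∨ q.2 - p.2 ≠ 0 := by
    by_contra! h
    exact hpq (Prod.ext (by omega) (by omega))
  rcases h with h | h
  · apply (mul_eq_zero.1 (?_ : (q.1 - p.1) * _ = 0)).resolve_left h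
    linear_combination (b.1 - a.1) * (hc - ha) - (c.1 - a.1) * (hb - ha)
  · apply (mul_eq_zero.1 (?_ : (q.2 - p.2) * _ = 0)).resolve_left h
    linear_combination (b.2 - a.2) * (hc - ha) - (c.2 - a.2) * (hb - ha)

theorem exists_functional (S : Finset (ℤ × ℤ)) :
    ∃ A : ℤ, ∀ p ∈ S, ∀ q ∈ S, A * p.1 + p.2 = A * q.1 + q.2 → p = q := by
  obtain ⟨M, hM⟩ : ∃ M : ℤ, ∀ p ∈ S, |p.2| ≤ M :=
    ⟨∑ p ∈ S, |p.2|, fun p hp => Finset.single_le_sum (f := fun p : ℤ × ℤ => |p.2|) (fun _ _ => abs_nonneg _) hp⟩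
  refine ⟨2 * M + 1, fun p hp q hq h => ?_⟩
  have h1 := abs_le.1 (hM p hp)
  have h2 := abs_le.1 (hM q hq)
  have : p.1 = q.1 := by
    rcases lt_trichotomy p.1 q.1 with h3 | h3 | h3
    · nlinarith
    · exact h3
    · nlinarith
  exact Prod.ext this (by rw [this] at h; linarith)

theorem exists_peel {S : Finset (ℤ × ℤ)} (hS : TriClosed S) (hN : NonCol S) (hc : 4 ≤ S.card) :
    ∃ v ∈ S, TriClosed (S.erase v) ∧ NonCol (S.erase v) := by
  obtain ⟨A, hA⟩ := exists_functional S
  have hne : S.Nonempty := Finset.card_pos.1 (by omega)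
  obtain ⟨M, hM, hMax⟩ := Finset.exists_max_image S (fun p => A * p.1 + p.2) hne
  obtain ⟨m, hm, hMin⟩ := Finset.exists_min_image S (fun p => A * p.1 + p.2) hne
  by_cases hN' : NonCol (S.erase M)
  · refine ⟨M, hM, erase_triClosed hS M A 1 fun p hp hpM => ?_, hN'⟩
    have := hMax p hp
    rcases lt_or_eq_of_le this with h | h
    · simpa using h
    · exact absurd (hA _ hp _ hM h) hpM
  · refine ⟨m, hm, erase_triClosed hS m (-A) (-1) fun p hp hpM => ?_, ?_⟩
    · have := hMin p hp
      rcases lt_or_eq_of_le this with h | h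
      · linarith
      · exact absurd (hA _ hp _ hm h.symm) hpM
    · have hcard : 1 < ((S.erase M).erase m).card := by
        have h1 := Finset.pred_card_le_card_erase (s := S) (a := M)
        have h2 := Finset.pred_card_le_card_erase (s := S.erase M) (a := m)
        omega
      obtain ⟨p, hp, q, hq, hpq⟩ := Finset.one_lt_card.1 hcard
      simp only [Finset.mem_erase] at hp hq
      have hcol : ∀ x ∈ S, x ≠ M → dt p q x = 0 := by
        intro x hx hxM
        by_contra h
        exact hN' ⟨p, by simp [hp], q, by simp [hq], x, by simp [hx, hxM], h⟩
      have hMne : dt p q M ≠ 0 := by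
        intro h0
        have hall : ∀ x ∈ S, dt p q x = 0 := fun x hx => by
          by_cases h : x = M
          · rw [h]; exact h0
          · exact hcol x hx h
        obtain ⟨a, ha, b, hb, c, hc, hd⟩ := hN
        exact hd (col_of_line hpq (hall a ha) (hall b hb) (hall c hc))
      refine ⟨p, by simp [hp], q, by simp [hq], M, ?_, hMne⟩
      rw [Finset.mem_erase]
      refine ⟨?_, hM⟩
      rintro rfl
      have := hA p hp.2.2 M hM (le_antisymm (hMax p hp.2.2) (hMin p hp.2.2))
      exact hp.1 this

def URel (R S : Finset (ℤ × ℤ)) : Prop :=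
  ∃ a b c, (dt a b c).natAbs = 1 ∧ S = R.image (amap a b c)

theorem base_case {S : Finset (ℤ × ℤ)} (hS : TriClosed S) (hN : NonCol S) (hc : S.card = 3) :
    URel {(0, 0), (0, 1), (1, 0)} S := by
  obtain ⟨a, ha, b, hb, c, hc', hd⟩ := hN
  have hab : a ≠ b := by rintro rfl; simp [dt] at hd
  have hac : a ≠ c := by rintro rfl; simp [dt] at hd
  have hbc : b ≠ c := by rintro rfl; apply hd; simp only [dt]; ring
  have hSe : S = {a, b, c} := by
    symm
    apply Finset.eq_of_subset_of_card_le
    · intro x; simp only [Finset.mem_insert, Finset.mem_singleton]; rintro (rfl | rfl | rfl) <;> assumption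
    · rw [hc, Finset.card_eq_three.2 ⟨a, b, c, hab, hac, hbc, rfl⟩]
  have hmem : ∀ x ∈ S, x = a ∨ x = b ∨ x = c := fun x hx => by
    rw [hSe] at hx; simpa using hx
  have hg : Int.gcd (b.1 - a.1) (b.2 - a.2) = 1 := by
    obtain ⟨k1, hk1⟩ := Int.gcd_dvd_left (b.1 - a.1) (b.2 - a.2)
    obtain ⟨k2, hk2⟩ := Int.gcd_dvd_right (b.1 - a.1) (b.2 - a.2)
    set g := Int.gcd (b.1 - a.1) (b.2 - a.2) with hgdef
    have hg0 : g ≠ 0 := by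
      intro h
      rw [h] at hk1 hk2
      exact hab (Prod.ext (by simp at hk1; omega) (by simp at hk2; omega))
    by_contra hg1
    have hp := hS a ha b hb b hb (a.1 + k1, a.2 + k2) (g - 1) 1 0 (by omega) (by omega) (by omega) (by omega)
      (by linear_combination -hk1) (by linear_combination -hk2)
    have hk : k1 ≠ 0 ∨ k2 ≠ 0 := by
      by_contra! h
      rw [h.1] at hk1; rw [h.2] at hk2
      exact hab (Prod.ext (by simp at hk1; omega) (by simp at hk2; omega))
    rcases hmem _ hp with h | h | h
    · have e1 := congrArg Prod.fst h
      have e2 := congrArg Prod.snd h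
      simp at e1 e2; omega
    · have e1 := congrArg Prod.fst h
      have e2 := congrArg Prod.snd h
      simp only at e1 e2
      have hg2 : (g : ℤ) - 1 ≠ 0 := by omega
      have f1 : ((g : ℤ) - 1) * k1 = 0 := by linear_combination -e1 - hk1
      have f2 : ((g : ℤ) - 1) * k2 = 0 := by linear_combination -e2 - hk2
      have := (mul_eq_zero.1 f1).resolve_left hg2
      have := (mul_eq_zero.1 f2).resolve_left hg2
      omega
    · apply hd
      rw [← h]; simp only [dt]
      linear_combination k2 * hk1 - k1 * hk2
  have hdet : (dt a b c).natAbs = 1 := by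
    rcases lt_or_gt_of_ne hd with h | h
    · obtain ⟨p, hp, hp1⟩ := visible hS ha hb hc' hg h
      rcases hmem p hp with rfl | rfl | rfl
      · simp [dt] at hp1
      · simp [dt, mul_comm] at hp1
      · rw [hp1]; rfl
    · have hg' : Int.gcd (a.1 - b.1) (a.2 - b.2) = 1 := by
        rw [← hg, ← neg_sub b.1, ← neg_sub b.2, Int.gcd_neg, Int.neg_gcd]
      have hba : ∀ x, dt b a x = - dt a b x := fun x => by simp only [dt]; ring
      obtain ⟨p, hp, hp1⟩ := visible hS hb ha hc' hg' (by rw [hba]; omega)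
      rcases hmem p hp with rfl | rfl | rfl
      · simp [dt, mul_comm] at hp1
      · simp [dt] at hp1
      · rw [hba] at hp1; omega
  refine ⟨a, b, c, hdet, ?_⟩
  rw [hSe]
  ext x
  simp [amap]
  tauto

structure GoodRep (n : ℕ) (r : List (ℤ × ℤ) × List (ℤ × ℤ × ℤ)) : Prop where
  len : r.1.length = n
  nodup : r.1.Nodup
  m0 : (0, 0) ∈ r.1
  m1 : (1, 0) ∈ r.1
  m2 : (0, 1) ∈ r.1
  edge : ∀ e ∈ r.2, Int.gcd e.1 e.2.1 = 1 ∧ (∀ p ∈ r.1, 0 ≤ hv e p) ∧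
    ∃ a ∈ r.1, hv e a = 0 ∧ (a.1 + e.2.1, a.2 - e.1) ∈ r.1
  box : ∀ v : ℤ × ℤ, (∀ e ∈ r.2, -1 ≤ hv e v) → v.1 ∈ rangeX ∧ v.2 ∈ rangeY
  inside : ∀ v : ℤ × ℤ, (∀ e ∈ r.2, 0 ≤ hv e v) → v ∈ r.1

theorem bddE_spec {E : List (ℤ × ℤ × ℤ)} {u1 u2 B : ℤ} (h : bddE E u1 u2 B = true) (v : ℤ × ℤ)
    (hv1 : ∀ e ∈ E, -1 ≤ hv e v) : u1 * v.1 + u2 * v.2 ≤ B := by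
  simp only [bddE, List.any_eq_true, Bool.and_eq_true, decide_eq_true_eq] at h
  obtain ⟨e, he, f, hf, ⟨⟨hd, hs⟩, ht⟩, hlt⟩ := h
  have h1 := hv1 e he
  have h2 := hv1 f hf
  simp only [hv] at h1 h2
  generalize hS : u2 * f.1 - u1 * f.2.1 = s at *
  generalize hT : u1 * e.2.1 - e.1 * u2 = t at *
  have h3 := mul_le_mul_of_nonneg_left h1 hs
  have h4 := mul_le_mul_of_nonneg_left h2 ht
  have key : (e.1 * f.2.1 - f.1 * e.2.1) * (u1 * v.1 + u2 * v.2) < (e.1 * f.2.1 - f.1 * e.2.1) * (B + 1) := by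
    refine lt_of_le_of_lt ?_ hlt
    have : (e.1 * f.2.1 - f.1 * e.2.1) * (u1 * v.1 + u2 * v.2) =
        -(s * (e.1 * v.1 + e.2.1 * v.2) + t * (f.1 * v.1 + f.2.1 * v.2)) := by
      rw [← hS, ← hT]; ring
    rw [this]; linarith
  have := lt_of_mul_lt_mul_left key hd.le
  omega

theorem goodRep_of_ok {n : ℕ} {r : List (ℤ × ℤ) × List (ℤ × ℤ × ℤ)} (h : okRep n r = true) :
    GoodRep n r := by
  simp only [okRep, Bool.and_eq_true, decide_eq_true_eq, mem?_iff, List.all_eq_true] at h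
  obtain ⟨⟨⟨⟨⟨⟨⟨⟨⟨⟨hl, hn⟩, h0⟩, h1⟩, h2⟩, hE⟩, b1⟩, b2⟩, b3⟩, b4⟩, hin⟩ := h
  have hbox : ∀ v : ℤ × ℤ, (∀ e ∈ r.2, -1 ≤ hv e v) → v.1 ∈ rangeX ∧ v.2 ∈ rangeY := by
    intro v hvv
    have c1 := bddE_spec b1 v hvv
    have c2 := bddE_spec b2 v hvv
    have c3 := bddE_spec b3 v hvv
    have c4 := bddE_spec b4 v hvv
    simp only [rangeX, rangeY, List.mem_cons, List.not_mem_nil, or_false]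
    constructor <;> omega
  refine ⟨hl, nodup?_iff hn, h0, h1, h2, ?_, hbox, ?_⟩
  · intro e he
    have := hE e he
    simp only [okE, Bool.and_eq_true, decide_eq_true_eq, List.all_eq_true, List.any_eq_true, mem?_iff] at this
    exact ⟨this.1.1, this.1.2, this.2⟩
  · intro v hvv
    obtain ⟨hx, hy⟩ := hbox v fun e he => by have := hvv e he; omega
    simp only [okIn, Bool.or_eq_true, decide_eq_true_eq, List.all_eq_true, List.any_eq_true, mem?_iff] at hin
    rcases hin _ hx _ hy with ⟨e, he, hlt⟩ | hm
    · exact absurd (hvv e he) (not_le.2 hlt)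
    · exact hm

theorem reps_good {n : ℕ} (h3 : 3 ≤ n) (h7 : n ≤ 7) : ∀ r ∈ reps n, GoodRep n r := by
  intro r hr
  apply goodRep_of_ok
  revert r
  rw [← List.all_eq_true]
  interval_cases n
  exacts [reps_ok3, reps_ok4, reps_ok5, reps_ok6, reps_ok7]

theorem stepAll_spec {n : ℕ} : ∀ {rs hs}, stepAll n rs hs = true → ∀ r ∈ rs, ∃ h, stepOK n r h = true
  | [], _, _, r, hr => by simp at hr
  | _ :: _, [], h, _, _ => by simp [stepAll] at h
  | r :: rs, h :: hs, H, r', hr' => by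
    simp only [stepAll, Bool.and_eq_true] at H
    rcases List.mem_cons.1 hr' with rfl | hr'
    · exact ⟨h, H.1⟩
    · exact stepAll_spec H.2 r' hr'

theorem step_all {n : ℕ} (h3 : 3 ≤ n) (h7 : n ≤ 6) : stepAll n (reps n) (hints n) = true := by
  interval_cases n
  exacts [step_ok3, step_ok4, step_ok5, step_ok6]

theorem step_match {n : ℕ} (h3 : 3 ≤ n) (h6 : n ≤ 6) {r} (hr : r ∈ reps n) {w : ℤ × ℤ}
    (hw : w ∉ r.1) (hh : ∀ e ∈ r.2, -1 ≤ hv e w) :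
    ∃ r' ∈ reps (n + 1), URel r'.1.toFinset (insert w r.1.toFinset) := by
  have hg := reps_good h3 (by omega) r hr
  obtain ⟨hs, hst⟩ := stepAll_spec (step_all h3 h6) r hr
  obtain ⟨hx, hy⟩ := hg.box w hh
  simp only [stepOK, Bool.or_eq_true, decide_eq_true_eq, List.all_eq_true, List.any_eq_true, mem?_iff] at hst
  rcases hst _ hx _ hy with (⟨e, he, hlt⟩ | hm) | ⟨⟨u, v, j, a1, a2, b1, b2, c1, c2⟩, hmem, hok⟩
  · exact absurd (hh e he) (not_le.2 hlt)
  · exact absurd hm hw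
  · simp only [okHint, Bool.and_eq_true] at hok
    obtain ⟨-, hok⟩ := hok
    split at hok
    · simp at hok
    · rename_i r' hr'
      have hr'm := List.mem_of_getElem? hr'
      have hg' := reps_good (by omega) (by omega) r' hr'm
      simp only [matchL, Bool.and_eq_true, decide_eq_true_eq, List.all_eq_true, mem?_iff] at hok
      refine ⟨r', hr'm, _, _, _, hok.1, ?_⟩
      symm
      apply Finset.eq_of_subset_of_card_le
      · intro x hx
        simp only [Finset.mem_image, List.mem_toFinset] at hx
        obtain ⟨p, hp, rfl⟩ := hx
        have := hok.2 p hp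
        simpa using this
      · rw [Finset.card_image_of_injective _ (amap_inj hok.1), Finset.card_insert_of_notMem (by simpa using hw),
          List.toFinset_card_of_nodup hg.nodup, List.toFinset_card_of_nodup hg'.nodup, hg.len, hg'.len]

theorem URel.trans {R S T : Finset (ℤ × ℤ)} (h1 : URel R S) (h2 : URel S T) : URel R T := by
  obtain ⟨a, b, c, h, rfl⟩ := h1
  obtain ⟨p, q, r, h', rfl⟩ := h2
  refine ⟨amap p q r a, amap p q r b, amap p q r c, ?_, ?_⟩
  · rw [dt_amap, Int.natAbs_mul, h, h']
  · rw [Finset.image_image]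
    congr 1
    ext1 x
    exact amap_comp _ _ _ _ _ _ _

theorem classify_step {n : ℕ} (h3 : 3 ≤ n) (h6 : n ≤ 6)
    (ih : ∀ S : Finset (ℤ × ℤ), TriClosed S → NonCol S → S.card = n → ∃ r ∈ reps n, URel r.1.toFinset S)
    (S : Finset (ℤ × ℤ)) (hS : TriClosed S) (hN : NonCol S) (hc : S.card = n + 1) :
    ∃ r ∈ reps (n + 1), URel r.1.toFinset S := by
  obtain ⟨v, hv', hT, hN'⟩ := exists_peel hS hN (by omega)
  obtain ⟨r, hr, a, b, c, hd, himg⟩ := ih _ hT hN' (by rw [Finset.card_erase_of_mem hv']; omega)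
  obtain ⟨w, rfl⟩ := amap_surj hd v
  have hinj := amap_inj hd
  have hSimg : S = (insert w r.1.toFinset).image (amap a b c) := by
    rw [Finset.image_insert, ← himg, Finset.insert_erase hv']
  have hmemS : ∀ p, amap a b c p ∈ S ↔ p ∈ insert w r.1.toFinset := fun p => by
    rw [hSimg]; exact hinj.mem_finset_image
  have hwr : w ∉ r.1 := by
    intro h
    have : amap a b c w ∈ S.erase (amap a b c w) := by
      rw [himg]; exact Finset.mem_image_of_mem _ (by simpa using h)
    simp at this
  have hTI : TriClosed (insert w r.1.toFinset) := by
    intro x hx y hy z hz p s t u hs ht hu hpos e1 e2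
    rw [← hmemS] at hx hy hz ⊢
    refine hS _ hx _ hy _ hz _ s t u hs ht hu hpos ?_ ?_
    · simp only [amap]; linear_combination (b.1 - a.1) * e1 + (c.1 - a.1) * e2
    · simp only [amap]; linear_combination (b.2 - a.2) * e1 + (c.2 - a.2) * e2
  have hg := reps_good h3 (by omega) r hr
  have hh : ∀ e ∈ r.2, -1 ≤ hv e w := by
    intro e he
    obtain ⟨hgcd, hpos, q, hq, hq0, hq2⟩ := hg.edge e he
    have hdt : ∀ x, dt q (q.1 + e.2.1, q.2 - e.1) x = hv e x := fun x => by
      simp only [dt, hv] at hq0 ⊢; linear_combination -hq0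
    by_contra hlt
    obtain ⟨p, hp, hp1⟩ := visible hTI (a := q) (b := (q.1 + e.2.1, q.2 - e.1)) (w := w)
      (by simp [hq]) (by simp [hq2]) (by simp)
      (by
        have e1 : q.1 + e.2.1 - q.1 = e.2.1 := by ring
        have e2 : q.2 - e.1 - q.2 = -e.1 := by ring
        simp only [e1, e2, Int.gcd_neg]
        rw [Int.gcd_comm]; exact hgcd)
      (by rw [hdt]; omega)
    rw [hdt] at hp1
    rcases Finset.mem_insert.1 hp with rfl | hp
    · omega
    · have := hpos p (by simpa using hp)
      omega
  obtain ⟨r', hr', hrel⟩ := step_match h3 h6 hr hwr hh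
  exact ⟨r', hr', hrel.trans ⟨a, b, c, hd, hSimg⟩⟩

theorem classify3 (S : Finset (ℤ × ℤ)) (hS : TriClosed S) (hN : NonCol S) (hc : S.card = 3) :
    ∃ r ∈ reps 3, URel r.1.toFinset S :=
  ⟨_, List.mem_singleton.2 rfl, by simpa using base_case hS hN hc⟩

theorem classify {n : ℕ} (h3 : 3 ≤ n) (h7 : n ≤ 7) : ∀ S : Finset (ℤ × ℤ), TriClosed S → NonCol S →
    S.card = n → ∃ r ∈ reps n, URel r.1.toFinset S := by
  induction n, h3 using Nat.le_induction with
  | base => exact classify3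
  | succ n h3 ih => exact classify_step h3 (by omega) (ih (by omega))

def rv (p : ℤ × ℤ) : Fin 2 → ℝ := intVec ![p.1, p.2]

@[simp] theorem rv_zero (p : ℤ × ℤ) : rv p 0 = p.1 := by simp [rv, intVec]
@[simp] theorem rv_one (p : ℤ × ℤ) : rv p 1 = p.2 := by simp [rv, intVec]

theorem rv_inj : Function.Injective rv := by
  intro p q h
  have h0 := congrFun h 0
  have h1 := congrFun h 1
  simp at h0 h1
  exact Prod.ext h0 h1

theorem intVec_eq (x : Fin 2 → ℤ) : intVec x = rv (x 0, x 1) := by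
  ext i; fin_cases i <;> simp [intVec]

theorem latticeSet_eq : latticeSet 2 = Set.range rv := by
  ext z
  constructor
  · rintro ⟨x, rfl⟩; exact ⟨_, (intVec_eq x).symm⟩
  · rintro ⟨p, rfl⟩; exact ⟨_, rfl⟩

def ptsOf (P : Set (Fin 2 → ℝ)) : Set (ℤ × ℤ) := {p | rv p ∈ P}

theorem ncard_pts (P : Set (Fin 2 → ℝ)) : (latticePts 2 P).ncard = (ptsOf P).ncard := by
  have : latticePts 2 P = (fun p : ℤ × ℤ => ![p.1, p.2]) '' ptsOf P := by
    ext x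
    simp only [latticePts, ptsOf, Set.mem_ofPred_eq, Set.mem_image]
    constructor
    · intro h
      refine ⟨(x 0, x 1), by rwa [← intVec_eq], ?_⟩
      ext i; fin_cases i <;> rfl
    · rintro ⟨p, hp, rfl⟩; exact hp
  rw [this]
  apply Set.ncard_image_of_injective
  intro p q h
  have h0 := congrFun h 0
  have h1 := congrFun h 1
  simp at h0 h1
  exact Prod.ext h0 h1

theorem hull_pts {P : Set (Fin 2 → ℝ)} (h : IsConvexLatticePolytope 2 P) :
    P = convexHull ℝ (rv '' ptsOf P) := by
  obtain ⟨V, rfl⟩ := h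
  apply Set.Subset.antisymm
  · apply convexHull_mono
    rintro _ ⟨x, hx, rfl⟩
    refine ⟨(x 0, x 1), ?_, (intVec_eq x).symm⟩
    change rv _ ∈ convexHull ℝ _
    rw [← intVec_eq]
    exact subset_convexHull _ _ ⟨x, hx, rfl⟩
  · apply convexHull_min _ (convex_convexHull _ _)
    rintro _ ⟨p, hp, rfl⟩
    exact hp

theorem triClosed_pts {P : Set (Fin 2 → ℝ)} (hP : Convex ℝ P) {S : Finset (ℤ × ℤ)}
    (hS : (S : Set (ℤ × ℤ)) = ptsOf P) : TriClosed S := by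
  have hmem : ∀ p, p ∈ S ↔ rv p ∈ P := fun p => by
    rw [← Finset.mem_coe, hS]; rfl
  intro a ha b hb c hc p s t u hs ht hu hpos h1 h2
  rw [hmem] at *
  have hs' : (0 : ℝ) ≤ s := by exact_mod_cast hs
  have ht' : (0 : ℝ) ≤ t := by exact_mod_cast ht
  have hu' : (0 : ℝ) ≤ u := by exact_mod_cast hu
  have hpos' : (0 : ℝ) < s + t + u := by exact_mod_cast hpos
  have h1' : ((s : ℝ) + t + u) * p.1 = s * a.1 + t * b.1 + u * c.1 := by exact_mod_cast h1
  have h2' : ((s : ℝ) + t + u) * p.2 = s * a.2 + t * b.2 + u * c.2 := by exact_mod_cast h2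
  have key := hP.sum_mem (t := Finset.univ) (w := ![(s : ℝ) / (s + t + u), t / (s + t + u), u / (s + t + u)])
    (z := ![rv a, rv b, rv c]) (by
      intro i _; fin_cases i <;> simp <;> positivity) (by
      simp [Fin.sum_univ_three]; field_simp) (by
      intro i _; fin_cases i <;> simpa)
  convert key using 1
  simp only [Fin.sum_univ_three]
  ext i
  fin_cases i
  · simp; field_simp; linarith
  · simp; field_simp; linarith

theorem nonCol_pts {P : Set (Fin 2 → ℝ)} (hL : IsConvexLatticePolytope 2 P) (hF : IsFullDim 2 P)
    {S : Finset (ℤ × ℤ)} (hS : (S : Set (ℤ × ℤ)) = ptsOf P) (hc : 3 ≤ S.card) : NonCol S := by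
  by_contra hN
  obtain ⟨p, hp, q, hq, hpq⟩ := Finset.one_lt_card.1 (show 1 < S.card by omega)
  have hcol : ∀ x ∈ S, dt p q x = 0 := by
    intro x hx
    by_contra h
    exact hN ⟨p, hp, q, hq, x, hx, h⟩
  let L : AffineSubspace ℝ (Fin 2 → ℝ) :=
    { carrier := {z | ((q.1 : ℝ) - p.1) * (z 1 - p.2) - (q.2 - p.2) * (z 0 - p.1) = 0}
      smul_vsub_vadd_mem' := by
        intro c x y z hx hy hz
        simp only [Set.mem_ofPred_eq, vsub_eq_sub, vadd_eq_add, Pi.add_apply, Pi.smul_apply, Pi.sub_apply,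
          smul_eq_mul] at *
        linear_combination c * hx - c * hy + hz }
  have hle : affineSpan ℝ P ≤ L := by
    rw [hull_pts hL, affineSpan_convexHull, affineSpan_le]
    rintro _ ⟨x, hx, rfl⟩
    rw [← hS] at hx
    have := hcol x hx
    simp only [dt] at this
    change ((q.1 : ℝ) - p.1) * (rv x 1 - p.2) - (q.2 - p.2) * (rv x 0 - p.1) = 0
    simp only [rv_zero, rv_one]
    exact_mod_cast this
  rw [hF] at hle
  have hall : ∀ z : Fin 2 → ℝ, ((q.1 : ℝ) - p.1) * (z 1 - p.2) - (q.2 - p.2) * (z 0 - p.1) = 0 :=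
    fun z => hle (AffineSubspace.mem_top ℝ _ z)
  have e1 := hall ![p.1, p.2 + 1]
  have e2 := hall ![p.1 + 1, p.2]
  simp at e1 e2
  apply hpq
  have e1' : (q.1 : ℝ) = p.1 := by linarith
  have e2' : (q.2 : ℝ) = p.2 := by linarith
  exact Prod.ext (by exact_mod_cast e1'.symm) (by exact_mod_cast e2'.symm)

/-- the real affine equivalence attached to a unimodular triple -/
def sig0 (a b c : ℤ × ℤ) (h : (dt a b c).natAbs = 1) : (Fin 2 → ℝ) ≃ₗ[ℝ] (Fin 2 → ℝ) where
  toFun z := ![z 0 * (b.1 - a.1) + z 1 * (c.1 - a.1), z 0 * (b.2 - a.2) + z 1 * (c.2 - a.2)]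
  map_add' x y := by ext i; fin_cases i <;> simp <;> ring
  map_smul' k x := by ext i; fin_cases i <;> simp <;> ring
  invFun z := ![dt a b c * (z 0 * (c.2 - a.2) - z 1 * (c.1 - a.1)),
    dt a b c * (z 1 * (b.1 - a.1) - z 0 * (b.2 - a.2))]
  left_inv z := by
    have h2 : (dt a b c : ℝ) * dt a b c = 1 := by exact_mod_cast natAbs_one_sq h
    simp only [dt] at h2 ⊢
    push_cast at h2 ⊢
    ext i; fin_cases i
    · simp; linear_combination z 0 * h2
    · simp; linear_combination z 1 * h2
  right_inv z := by
    have h2 : (dt a b c : ℝ) * dt a b c = 1 := by exact_mod_cast natAbs_one_sq h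
    simp only [dt] at h2 ⊢
    push_cast at h2 ⊢
    ext i; fin_cases i
    · simp; linear_combination z 0 * h2
    · simp; linear_combination z 1 * h2

def sig1 (a b c : ℤ × ℤ) (h : (dt a b c).natAbs = 1) : (Fin 2 → ℝ) ≃ᵃ[ℝ] (Fin 2 → ℝ) :=
  (sig0 a b c h).toAffineEquiv.trans (AffineEquiv.constVAdd ℝ _ (rv a))

theorem sig1_rv (a b c : ℤ × ℤ) (h : (dt a b c).natAbs = 1) (p : ℤ × ℤ) :
    sig1 a b c h (rv p) = rv (amap a b c p) := by
  ext i
  fin_cases i <;> simp [sig1, sig0, amap] <;> ring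

theorem latticeEquiv_of_urel {R : Finset (ℤ × ℤ)} {S : Finset (ℤ × ℤ)} (h : URel R S) :
    LatticeEquiv 2 (convexHull ℝ (rv '' (R : Set (ℤ × ℤ)))) (convexHull ℝ (rv '' (S : Set (ℤ × ℤ)))) := by
  obtain ⟨a, b, c, h, rfl⟩ := h
  refine ⟨sig1 a b c h, ?_, ?_⟩
  · rw [latticeSet_eq]
    ext z
    constructor
    · rintro ⟨_, ⟨p, rfl⟩, rfl⟩
      exact ⟨_, (sig1_rv a b c h p).symm⟩
    · rintro ⟨q, rfl⟩
      obtain ⟨p, rfl⟩ := amap_surj h q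
      exact ⟨rv p, ⟨p, rfl⟩, sig1_rv a b c h p⟩
  · have := AffineMap.image_convexHull (sig1 a b c h : (Fin 2 → ℝ) →ᵃ[ℝ] (Fin 2 → ℝ)) (rv '' (R : Set (ℤ × ℤ)))
    rw [AffineEquiv.coe_toAffineMap] at this
    rw [this, Finset.coe_image, Set.image_image, Set.image_image]
    simp only [sig1_rv]

theorem exists_amap {σ : (Fin 2 → ℝ) ≃ᵃ[ℝ] (Fin 2 → ℝ)} (hσ : σ '' latticeSet 2 = latticeSet 2) :
    ∃ a b c, (dt a b c).natAbs = 1 ∧ ∀ p, σ (rv p) = rv (amap a b c p) := by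
  rw [latticeSet_eq] at hσ
  have hf : ∀ p, ∃ q, σ (rv p) = rv q := fun p => by
    have : σ (rv p) ∈ σ '' Set.range rv := ⟨_, ⟨p, rfl⟩, rfl⟩
    rw [hσ] at this
    obtain ⟨q, hq⟩ := this
    exact ⟨q, hq.symm⟩
  obtain ⟨a, ha⟩ := hf (0, 0)
  obtain ⟨b, hb⟩ := hf (1, 0)
  obtain ⟨c, hc⟩ := hf (0, 1)
  have hall : ∀ p, σ (rv p) = rv (amap a b c p) := by
    intro p
    have e : rv p = ((p.1 : ℝ) • (rv (1, 0) - rv (0, 0)) + (p.2 : ℝ) • (rv (0, 1) - rv (0, 0))) +ᵥ rv (0, 0) := by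
      ext i; fin_cases i <;> simp
    have l1 : σ.linear (rv (1, 0) - rv (0, 0)) = rv b - rv a := by
      rw [← ha, ← hb]; exact σ.toAffineMap.linearMap_vsub _ _
    have l2 : σ.linear (rv (0, 1) - rv (0, 0)) = rv c - rv a := by
      rw [← ha, ← hc]; exact σ.toAffineMap.linearMap_vsub _ _
    rw [e, AffineEquiv.map_vadd, map_add, map_smul, map_smul, l1, l2, ha]
    ext i; fin_cases i <;> simp [amap] <;> ring
  refine ⟨a, b, c, ?_, hall⟩
  have hs : ∀ q, ∃ p, amap a b c p = q := fun q => by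
    have : rv q ∈ σ '' Set.range rv := by rw [hσ]; exact ⟨q, rfl⟩
    obtain ⟨_, ⟨p, rfl⟩, hp⟩ := this
    rw [hall] at hp
    exact ⟨p, rv_inj hp⟩
  obtain ⟨p, hp⟩ := hs (0, 0)
  obtain ⟨q, hq⟩ := hs (1, 0)
  obtain ⟨r, hr⟩ := hs (0, 1)
  have := dt_amap a b c p q r
  rw [hp, hq, hr] at this
  have h1 : dt a b c * dt p q r = 1 := by rw [← this]; simp [dt]
  rcases Int.mul_eq_one_iff_eq_one_or_neg_one.1 h1 with h | h <;> simp [h.1]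

def sigS (S : Set (ℤ × ℤ)) : ℕ :=
  ∑ᶠ a ∈ S, (∑ᶠ b ∈ S, ∑ᶠ c ∈ S, (dt a b c).natAbs) ^ 2

theorem sigS_invariant {P₁ P₂ : Set (Fin 2 → ℝ)} (h : LatticeEquiv 2 P₁ P₂) :
    sigS (ptsOf P₁) = sigS (ptsOf P₂) := by
  obtain ⟨σ, hσ, rfl⟩ := h
  obtain ⟨a, b, c, hd, hall⟩ := exists_amap hσ
  have himg : ptsOf (σ '' P₁) = amap a b c '' ptsOf P₁ := by
    ext q
    constructor
    · rintro ⟨z, hz, hzq⟩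
      obtain ⟨p, rfl⟩ := amap_surj hd q
      rw [← hall] at hzq
      exact ⟨p, by have := σ.injective hzq; subst this; exact hz, rfl⟩
    · rintro ⟨p, hp, rfl⟩
      exact ⟨rv p, hp, hall p⟩
  have hi := (amap_inj hd).injOn (s := ptsOf P₁)
  rw [himg]
  simp only [sigS, finsum_mem_image hi, dt_amap, Int.natAbs_mul, hd, one_mul]

theorem sumL_eq {R : List (ℤ × ℤ)} (h : R.Nodup) (f : ℤ × ℤ → ℕ) :
    ∑ᶠ a ∈ {x | x ∈ R}, f a = sumL R f := by
  have : {x | x ∈ R} = (R.toFinset : Set (ℤ × ℤ)) := by ext; simp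
  rw [this, finsum_mem_coe_finset, sumL, List.sum_toFinset _ h]

theorem sigS_list {R : List (ℤ × ℤ)} (h : R.Nodup) : sigS {x | x ∈ R} = sigL R := by
  simp only [sigS, sumL_eq h, sigL]

def hullL (R : List (ℤ × ℤ)) : Set (Fin 2 → ℝ) := convexHull ℝ (rv '' (R.toFinset : Set (ℤ × ℤ)))

theorem hullL_polytope (R : List (ℤ × ℤ)) : IsConvexLatticePolytope 2 (hullL R) := by
  refine ⟨R.toFinset.image fun p => ![p.1, p.2], ?_⟩
  rw [Finset.coe_image, Set.image_image]
  rfl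

theorem hullL_full {n r} (h : GoodRep n r) : IsFullDim 2 (hullL r.1) := by
  rw [IsFullDim, hullL, affineSpan_convexHull, eq_top_iff]
  intro z _
  have m : ∀ p ∈ r.1, rv p ∈ affineSpan ℝ (rv '' (r.1.toFinset : Set (ℤ × ℤ))) := fun p hp =>
    subset_affineSpan _ _ ⟨p, by simpa using hp, rfl⟩
  have h1 := AffineSubspace.smul_vsub_vadd_mem _ (z 0) (m _ h.m1) (m _ h.m0) (m _ h.m0)
  have h2 := AffineSubspace.smul_vsub_vadd_mem _ (z 1) (m _ h.m2) (m _ h.m0) h1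
  convert h2 using 1
  ext i; fin_cases i <;> simp

theorem hullL_pts {n r} (h : GoodRep n r) : ptsOf (hullL r.1) = {x | x ∈ r.1} := by
  ext p
  constructor
  · intro hp
    apply h.inside
    intro e he
    have hsub : hullL r.1 ⊆ {z | 0 ≤ (e.1 : ℝ) * z 0 + e.2.1 * z 1 + e.2.2} := by
      apply convexHull_min
      · rintro _ ⟨q, hq, rfl⟩
        have := (h.edge e he).2.1 q (by simpa using hq)
        simp only [hv] at this
        simp only [Set.mem_ofPred_eq, rv_zero, rv_one]
        exact_mod_cast this
      · intro x hx y hy s t hs ht hst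
        simp only [Set.mem_ofPred_eq, Pi.add_apply, Pi.smul_apply, smul_eq_mul] at *
        have := add_nonneg (mul_nonneg hs hx) (mul_nonneg ht hy)
        have e3 : (e.2.2 : ℝ) = (s + t) * e.2.2 := by rw [hst, one_mul]
        linarith
    have := hsub hp
    simp only [Set.mem_ofPred_eq, rv_zero, rv_one] at this
    simp only [hv]
    exact_mod_cast this
  · intro hp
    exact subset_convexHull _ _ ⟨p, by simpa using hp, rfl⟩

theorem kappa_eq {n : ℕ} (h3 : 3 ≤ n) (h7 : n ≤ 7)
    (hsig : ((reps n).map fun r => sigL r.1).Nodup) : kappaTwo n = (reps n).length := by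
  have hg : ∀ i : Fin (reps n).length, GoodRep n ((reps n).get i) := fun i =>
    reps_good h3 h7 _ (List.get_mem _ _)
  let F : Fin (reps n).length → ClassesType 2 (fun P => (latticePts 2 P).ncard = n) := fun i =>
    Quot.mk _ ⟨hullL ((reps n).get i).1, hullL_polytope _, hullL_full (hg i), by
      beta_reduce
      rw [ncard_pts, hullL_pts (hg i)]
      have : {x | x ∈ ((reps n).get i).1} = (((reps n).get i).1.toFinset : Set (ℤ × ℤ)) := by ext; simp
      rw [this, Set.ncard_coe_finset, List.toFinset_card_of_nodup (hg i).nodup, (hg i).len]⟩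
  have hF : Function.Bijective F := by
    constructor
    · intro i j hij
      let G : ClassesType 2 (fun P => (latticePts 2 P).ncard = n) → ℕ :=
        Quot.lift (fun P => sigS (ptsOf P.1)) (fun _ _ h => sigS_invariant h)
      have := congrArg G hij
      change sigS (ptsOf (hullL _)) = sigS (ptsOf (hullL _)) at this
      rw [hullL_pts (hg i), hullL_pts (hg j), sigS_list (hg i).nodup, sigS_list (hg j).nodup] at this
      have hinj := List.nodup_iff_injective_get.1 hsig
      have h2 : (⟨i.1, by simp⟩ : Fin ((reps n).map fun r => sigL r.1).length) = ⟨j.1, by simp⟩ := by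
        apply hinj
        simpa using this
      exact Fin.ext (by simpa using h2)
    · intro x
      obtain ⟨⟨P, hL, hFd, hcard⟩, rfl⟩ := Quot.exists_rep x
      rw [ncard_pts] at hcard
      have hfin : (ptsOf P).Finite := Set.finite_of_ncard_ne_zero (by omega)
      obtain ⟨S, hS⟩ := hfin.exists_finset_coe
      have hSc : S.card = n := by rw [← hcard, ← hS, Set.ncard_coe_finset]
      have hconv : Convex ℝ P := by rw [hull_pts hL]; exact convex_convexHull _ _
      obtain ⟨r, hr, hrel⟩ := classify h3 h7 S (triClosed_pts hconv hS) (nonCol_pts hL hFd hS (by omega)) hSc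
      obtain ⟨i, rfl⟩ := List.get_of_mem hr
      refine ⟨i, Quot.sound ?_⟩
      change LatticeEquiv 2 (hullL _) P
      have := latticeEquiv_of_urel hrel
      rw [hS, ← hull_pts hL] at this
      exact this
  rw [kappaTwo, ← Nat.card_eq_of_bijective F hF, Nat.card_eq_fintype_card, Fintype.card_fin]

/-- The values of `κ(2,w)` for `3 ≤ w ≤ 7`. -/
theorem kappaTwo_values :
    kappaTwo 3 = 1 ∧ kappaTwo 4 = 3 ∧ kappaTwo 5 = 6 ∧ kappaTwo 6 = 13 ∧
      kappaTwo 7 = 21 := by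
  refine ⟨?_, ?_, ?_, ?_, ?_⟩
  · exact kappa_eq (by norm_num) (by norm_num) (sig_ok _ (by simp))
  · exact kappa_eq (by norm_num) (by norm_num) (sig_ok _ (by simp))
  · exact kappa_eq (by norm_num) (by norm_num) (sig_ok _ (by simp))
  · exact kappa_eq (by norm_num) (by norm_num) (sig_ok _ (by simp))
  · exact kappa_eq (by norm_num) (by norm_num) (sig_ok _ (by simp))

end
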